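/- Let π, σ, τ be permutations of Fin n. Pushing setoids forward along the bijection of Fin n ⊕ Fin n given by inl x ↦ inl (π⁻¹ x) and inr y ↦ inr y restricts to a bijection from the set of propagating setoids r on Fin n ⊕ Fin n satisfying G(σ) ≤ r and G(τ) ≤ r onto the set of propagating setoids r satisfying G(σ * π) ≤ r and G(τ * π) ≤ r, where σ * π denotes the product in the symmetric group (apply π first, then σ). -/

import Mathlib

/-- The setoid on `Fin n ⊕ Fin n` generated by the pairs `inl x ≈ inr (σ x)`,
for `σ` a permutation of `Fin n`. -/
def permSetoid {n : ℕ} (σ : Equiv.Perm (Fin n)) : Setoid (Fin n ⊕ Fin n) :=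
  Relation.EqvGen.setoid (fun a b => ∃ x : Fin n, a = Sum.inl x ∧ b = Sum.inr (σ x))

/-- A setoid on `Fin n ⊕ Fin n` is propagating if every equivalence class contains
an element of the left summand and an element of the right summand. -/
def Propagating {n : ℕ} (r : Setoid (Fin n ⊕ Fin n)) : Prop :=
  ∀ a : Fin n ⊕ Fin n,
    (∃ x : Fin n, r a (Sum.inl x)) ∧ (∃ y : Fin n, r a (Sum.inr y))

/-- The pushforward of a setoid `r` along a bijection `e`: it relates `e a` and `e b`
iff `r` relates `a` and `b`. -/
def pushSetoid {X : Type*} (e : X ≃ X) (r : Setoid X) : Setoid X :=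
  Setoid.comap (fun x => e.symm x) r

theorem permSetoid_le_iff {n : ℕ} (σ : Equiv.Perm (Fin n)) (r : Setoid (Fin n ⊕ Fin n)) :
    permSetoid σ ≤ r ↔ ∀ x, r (Sum.inl x) (Sum.inr (σ x)) := by
  refine ⟨fun h x => h (Relation.EqvGen.rel _ _ ⟨x, rfl, rfl⟩), fun h => ?_⟩
  refine Setoid.eqvGen_le ?_
  rintro _ _ ⟨x, rfl, rfl⟩
  exact h x

theorem pushSetoid_rel {X : Type*} (e : X ≃ X) (r : Setoid X) (a b : X) :
    pushSetoid e r a b ↔ r (e.symm a) (e.symm b) :=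
  Iff.rfl

/-- Pushing forward along a bijection is a bijection on setoids, with inverse the pushforward
along the inverse bijection. -/
def pushSetoidEquiv {X : Type*} (e : X ≃ X) : Setoid X ≃ Setoid X where
  toFun := pushSetoid e
  invFun := pushSetoid e.symm
  left_inv r := by ext a b; simp [pushSetoid_rel]
  right_inv r := by ext a b; simp [pushSetoid_rel]

theorem propagating_pushSetoid_sumCongr_iff {n : ℕ} (α β : Equiv.Perm (Fin n))
    (r : Setoid (Fin n ⊕ Fin n)) :
    Propagating (pushSetoid (Equiv.sumCongr α β) r) ↔ Propagating r := by
  refine (Equiv.sumCongr α β).symm.forall_congr fun a => and_congr ?_ ?_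
  · exact α.symm.exists_congr fun x => Iff.rfl
  · exact β.symm.exists_congr fun y => Iff.rfl

theorem permSetoid_mul_le_pushSetoid_iff {n : ℕ} (π σ : Equiv.Perm (Fin n))
    (r : Setoid (Fin n ⊕ Fin n)) :
    permSetoid (σ * π) ≤
        pushSetoid (Equiv.sumCongr (π⁻¹ : Equiv.Perm (Fin n)) (Equiv.refl (Fin n))) r ↔
      permSetoid σ ≤ r := by
  rw [permSetoid_le_iff, permSetoid_le_iff]
  exact π.forall_congr_right (q := fun x => r (Sum.inl x) (Sum.inr (σ x)))

/-- Pushing setoids forward along the bijection `inl x ↦ inl (π⁻¹ x)`, `inr y ↦ inr y`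
restricts to a bijection from the propagating setoids containing `G σ` and `G τ` onto
the propagating setoids containing `G (σ * π)` and `G (τ * π)`. -/
theorem pushSetoid_right_bijOn {n : ℕ} (π σ τ : Equiv.Perm (Fin n)) :
    Set.BijOn (pushSetoid (Equiv.sumCongr (π⁻¹ : Equiv.Perm (Fin n)) (Equiv.refl (Fin n))))
      {r : Setoid (Fin n ⊕ Fin n) | Propagating r ∧ permSetoid σ ≤ r ∧ permSetoid τ ≤ r}
      {r : Setoid (Fin n ⊕ Fin n) |
        Propagating r ∧ permSetoid (σ * π) ≤ r ∧ permSetoid (τ * π) ≤ r} := by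
  exact (pushSetoidEquiv _).bijOn fun r => and_congr
    (propagating_pushSetoid_sumCongr_iff _ _ r)
    (and_congr (permSetoid_mul_le_pushSetoid_iff π σ r) (permSetoid_mul_le_pushSetoid_iff π τ r))
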